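/- Let q ≥ 3 be a natural number. The number of functions f : {1,...,q} → {1,...,q} that are order-decreasing (f(i) ≤ i for all i), order-preserving (i ≤ j implies f(i) ≤ f(j)), and satisfy f(q) ≠ q and f(2) = 1, equals catalan(q) − 2·catalan(q−1) + catalan(q−2), where catalan(m) denotes the m-th Catalan number (1/(m+1))·binomial(2m, m). -/

import Mathlib

/-- The ballot number `(n - k + 1) / (n + 1) * (n + k).choose n` for `k ≤ n + 1`, as a difference of
binomial coefficients. -/
def ballot (n k : ℕ) : ℤ := (n + k).choose n - (n + k).choose (n + 1)

theorem ballot_zero_right (n : ℕ) : ballot n 0 = 1 := by simp [ballot]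

theorem ballot_succ_succ (n k : ℕ) :
    ballot (n + 1) (k + 1) = ballot (n + 1) k + ballot n (k + 1) := by
  have h : n + 1 + (k + 1) = (n + (k + 1)) + 1 := by ring
  have h' : n + 1 + k = n + (k + 1) := by ring
  simp only [ballot, h, h', Nat.choose_succ_succ']
  push_cast
  ring

theorem ballot_self_succ (n : ℕ) : ballot n (n + 1) = 0 := by
  have h : (n + (n + 1)).choose n = (n + (n + 1)).choose (n + 1) := Nat.choose_symm_add
  simp [ballot, h]

theorem ballot_succ_self_succ (n : ℕ) : ballot (n + 1) (n + 1) = ballot (n + 1) n := by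
  rw [ballot_succ_succ, ballot_self_succ, add_zero]

theorem ballot_self (n : ℕ) : ballot n n = catalan n := by
  have h₁ : ((n : ℤ) + 1) * catalan n = (n + n).choose n := by
    have := succ_mul_catalan_eq_centralBinom n
    rw [Nat.centralBinom, two_mul] at this
    exact_mod_cast this
  have h₂ : ((n + n).choose (n + 1) : ℤ) * (n + 1) = (n + n).choose n * n := by
    have := Nat.choose_succ_right_eq (n + n) n
    rw [Nat.add_sub_cancel] at this
    exact_mod_cast this
  have h₃ : (n : ℤ) + 1 ≠ 0 := by positivity
  apply mul_left_cancel₀ h₃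
  rw [ballot]
  linear_combination -h₁ - h₂

theorem two_mul_catalan_le (n : ℕ) : 2 * catalan (n + 1) ≤ catalan (n + 2) := by
  rw [catalan_succ (n + 1), Fin.sum_univ_succ, Fin.sum_univ_castSucc]
  simp
  omega

/-- The order-preserving, order-decreasing sequences of length `n` with values at most `k` whose
entry at index `1` vanishes. -/
def flatStartSeqs (n k : ℕ) : Set (Fin n → ℕ) :=
  {f | (∀ i, f i ≤ i) ∧ Monotone f ∧ (∀ i, f i ≤ k) ∧ ∀ i : Fin n, (i : ℕ) = 1 → f i = 0}

theorem finite_flatStartSeqs (n k : ℕ) : (flatStartSeqs n k).Finite :=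
  (Set.finite_Iic fun _ : Fin n => k).subset fun _ hf => hf.2.2.1

theorem ncard_flatStartSeqs_zero_right (n : ℕ) : (flatStartSeqs n 0).ncard = 1 := by
  rw [Set.ncard_eq_one]
  refine ⟨0, Set.eq_singleton_iff_unique_mem.2 ⟨?_, fun f hf => ?_⟩⟩
  · exact ⟨fun _ => Nat.zero_le _, monotone_const, fun _ => le_rfl, fun _ _ => rfl⟩
  · ext i
    exact Nat.le_zero.1 (hf.2.2.1 i)

theorem flatStartSeqs_two_one : flatStartSeqs 2 1 = flatStartSeqs 2 0 := by
  ext f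
  simp only [flatStartSeqs, Set.mem_ofPred_eq, Fin.forall_fin_two]
  refine and_congr_right fun h => and_congr_right fun _ => ?_
  simp at h ⊢
  omega

theorem flatStartSeqs_self_succ (n : ℕ) :
    flatStartSeqs (n + 1) (n + 1) = flatStartSeqs (n + 1) n := by
  ext f
  refine and_congr_right fun h => and_congr_right fun _ => and_congr_left fun _ => ?_
  exact ⟨fun _ i => (h i).trans i.is_le, fun h' i => (h' i).trans n.le_succ⟩

theorem flatStartSeqs_succ_succ {n k : ℕ} (hn : 2 ≤ n) (hk : k + 1 ≤ n) :
    flatStartSeqs (n + 1) (k + 1) = flatStartSeqs (n + 1) k ∪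
      (fun f => Fin.snoc (α := fun _ => ℕ) f (k + 1)) '' flatStartSeqs n (k + 1) := by
  ext f
  constructor
  · rintro ⟨hle, hmono, hbd, hone⟩
    rcases (hbd (Fin.last n)).lt_or_eq with h | h
    · exact Or.inl ⟨hle, hmono, fun i => (hmono i.le_last).trans (Nat.lt_succ_iff.1 h), hone⟩
    · refine Or.inr ⟨Fin.init f, ⟨fun i => hle i.castSucc,
        fun i j hij => hmono (Fin.castSucc_le_castSucc_iff.2 hij), fun i => hbd i.castSucc,
        fun i hi => hone i.castSucc hi⟩, ?_⟩
      simp only [← h, Fin.snoc_init_self]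
  · rintro (⟨hle, hmono, hbd, hone⟩ | ⟨g, ⟨hle, hmono, hbd, hone⟩, rfl⟩)
    · exact ⟨hle, hmono, fun i => (hbd i).trans k.le_succ, hone⟩
    · refine ⟨fun i => ?_, fun i j hij => ?_, fun i => ?_, fun i hi => ?_⟩
      · cases i using Fin.lastCases with
        | last => simpa using hk
        | cast i => simpa using hle i
      · cases j using Fin.lastCases with
        | last =>
          cases i using Fin.lastCases with
          | last => exact le_rfl
          | cast i => simpa using hbd i
        | cast j =>
          cases i using Fin.lastCases with
          | last => exact absurd hij (Fin.castSucc_lt_last j).not_ge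
          | cast i => simpa using hmono (Fin.castSucc_le_castSucc_iff.1 hij)
      · cases i using Fin.lastCases with
        | last => simp
        | cast i => simpa using hbd i
      · cases i using Fin.lastCases with
        | last => simp at hi; omega
        | cast i => simpa using hone i hi

theorem ncard_flatStartSeqs_succ_succ {n k : ℕ} (hn : 2 ≤ n) (hk : k + 1 ≤ n) :
    (flatStartSeqs (n + 1) (k + 1)).ncard =
      (flatStartSeqs (n + 1) k).ncard + (flatStartSeqs n (k + 1)).ncard := by
  rw [flatStartSeqs_succ_succ hn hk, Set.ncard_union_eq _ (finite_flatStartSeqs _ _)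
    ((finite_flatStartSeqs _ _).image _), Set.ncard_image_of_injective]
  · intro f g h
    exact (Fin.snoc_injective2 h).1
  · rw [Set.disjoint_right]
    rintro _ ⟨g, _, rfl⟩ ⟨_, _, hbd, _⟩
    simpa using hbd (Fin.last n)

theorem ncard_flatStartSeqs {n k : ℕ} (hk : k ≤ n + 1) :
    ((flatStartSeqs (n + 2) (k + 1)).ncard : ℤ) = ballot (n + 2) (k + 1) - ballot (n + 1) k := by
  induction n generalizing k with
  | zero =>
    have h : (flatStartSeqs 2 1).ncard = 1 := by
      rw [flatStartSeqs_two_one, ncard_flatStartSeqs_zero_right]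
    obtain rfl | rfl : k = 0 ∨ k = 1 := by omega
    · simp [h, ballot]
    · rw [flatStartSeqs_self_succ 1, h]
      simp [ballot, Nat.choose]
  | succ n ih =>
    induction k with
    | zero =>
      rw [ncard_flatStartSeqs_succ_succ (by omega) (by omega), ncard_flatStartSeqs_zero_right,
        Nat.cast_add, ih (by omega)]
      simp only [ballot_succ_succ _ 0, ballot_zero_right]
      push_cast
      ring
    | succ k ihk =>
      rcases hk.lt_or_eq with hlt | heq
      · rw [ncard_flatStartSeqs_succ_succ (by omega) (by omega), Nat.cast_add, ihk (by omega),
          ih (by omega), ballot_succ_succ (n + 2) (k + 1), ballot_succ_succ (n + 1) k]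
        ring
      · obtain rfl : k = n + 1 := by omega
        rw [flatStartSeqs_self_succ, ihk (by omega), ballot_succ_self_succ (n + 2),
          ballot_succ_self_succ (n + 1)]

/-- STATEMENT 16: for `q ≥ 3`, the number of order-decreasing and order-preserving
transformations `f` of `{1, …, q}` (modelled by `Fin q`, so that the element `2` is
`⟨1, _⟩` and `1` is `⟨0, _⟩`) with `f(q) ≠ q` and `f(2) = 1` equals
`catalan q - 2 * catalan (q - 1) + catalan (q - 2)`. -/
theorem statement16 (q : ℕ) (hq : 3 ≤ q) :
    Set.ncard {f : Fin q → Fin q |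
        (∀ i, f i ≤ i) ∧ (∀ i j, i ≤ j → f i ≤ f j) ∧
        f ⟨q - 1, by omega⟩ ≠ ⟨q - 1, by omega⟩ ∧
        f ⟨1, by omega⟩ = ⟨0, by omega⟩} =
      catalan q - 2 * catalan (q - 1) + catalan (q - 2) := by
  obtain ⟨n, rfl⟩ : ∃ n, q = n + 3 := ⟨q - 3, by omega⟩
  rw [← Set.ncard_image_of_injective _ (Fin.val_injective.comp_left (α := Fin (n + 3)))]
  have hset : (fun f : Fin (n + 3) → Fin (n + 3) => Fin.val ∘ f) ''
      {f | (∀ i, f i ≤ i) ∧ (∀ i j, i ≤ j → f i ≤ f j) ∧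
        f ⟨n + 3 - 1, by omega⟩ ≠ ⟨n + 3 - 1, by omega⟩ ∧ f ⟨1, by omega⟩ = ⟨0, by omega⟩} =
      flatStartSeqs (n + 3) (n + 1) := by
    ext g
    constructor
    · rintro ⟨f, ⟨hle, hmono, hlast, hone⟩, rfl⟩
      refine ⟨hle, hmono, fun i => ?_, fun i hi => ?_⟩
      · have h₁ : (f i : ℕ) ≤ f (Fin.last (n + 2)) := hmono _ _ i.le_last
        have h₂ : (f (Fin.last (n + 2)) : ℕ) ≠ n + 2 := fun h => hlast (Fin.ext h)
        have h₃ := (f (Fin.last (n + 2))).isLt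
        simp only [Function.comp_apply]
        omega
      · have hi' : i = ⟨1, by omega⟩ := Fin.ext hi
        simp only [Function.comp_apply, hi', hone]
    · rintro ⟨hle, hmono, hbd, hone⟩
      refine ⟨fun i => ⟨g i, (hle i).trans_lt i.isLt⟩, ⟨hle, fun i j hij => hmono hij, ?_,
        Fin.ext (hone _ rfl)⟩, rfl⟩
      intro h
      have h₁ := congrArg Fin.val h
      have h₂ := hbd ⟨n + 3 - 1, by omega⟩
      simp only at h₁
      omega
  have hcard : ((flatStartSeqs (n + 3) (n + 1)).ncard : ℤ) =
      ballot (n + 3) (n + 1) - ballot (n + 2) n := ncard_flatStartSeqs (by omega)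
  have h₁ := ballot_succ_succ (n + 2) (n + 1)
  have h₂ := ballot_succ_succ (n + 1) n
  have h₃ := ballot_succ_self_succ (n + 2)
  have h₄ := ballot_succ_self_succ (n + 1)
  have h₅ := ballot_self (n + 3)
  have h₆ := ballot_self (n + 2)
  have h₇ := ballot_self (n + 1)
  have h₈ := two_mul_catalan_le (n + 1)
  have hs : (flatStartSeqs (n + 3) (n + 1)).ncard =
      catalan (n + 3) - 2 * catalan (n + 2) + catalan (n + 1) := by
    simp only [add_assoc, Nat.reduceAdd] at h₁ h₂ h₃ h₄ h₈
    omega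
  exact (congrArg Set.ncard hset).trans hs
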